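/- Let V : ℝⁿ → ℝ be a convex function whose Fenchel-Legendre transform V* is also finite everywhere on ℝⁿ. Let η and η* be the probability measures proportional to e^{-V} and e^{-V*} respectively, and let ν = (∇V)#η and ν* = (∇V*)#η* be their moment measures. If H(η) + H(η*) ≤ −n·log(c·e²) + 𝒯(ν, ν*) for some constant c > 0, then ∫ e^{-V(x)} dx · ∫ e^{-V*(x)} dx ≥ cⁿ. -/

import Mathlib

open MeasureTheory Real Set
open scoped ENNReal InnerProductSpace

noncomputable section

variable {E : Type*} [NormedAddCommGroup E] [InnerProductSpace ℝ E]

/-- Convexity for extended-real-valued functions. -/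
def ConvexEReal (f : E → EReal) : Prop :=
  ∀ x y : E, ∀ a b : ℝ, 0 ≤ a → 0 ≤ b → a + b = 1 →
    f (a • x + b • y) ≤ (a : EReal) * f x + (b : EReal) * f y

/-- The class `𝓕` of proper convex lower semicontinuous functions `E → ℝ ∪ {+∞}`. -/
def IsProperConvexLSC (f : E → EReal) : Prop :=
  ConvexEReal f ∧ LowerSemicontinuous f ∧ (∀ x, f x ≠ ⊥) ∧ (∃ x, f x ≠ ⊤)

/-- Fenchel-Legendre transform of an extended-real-valued function. -/
def fenchel (f : E → EReal) (y : E) : EReal := ⨆ x : E, (⟪x, y⟫_ℝ : EReal) - f x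

/-- Fenchel-Legendre transform of a real-valued function. -/
def fenchelR (f : E → ℝ) (y : E) : EReal := ⨆ x : E, ((⟪x, y⟫_ℝ - f x : ℝ) : EReal)

/-- positive part of an extended real, as `ℝ≥0∞`. -/
def ERealPos (t : EReal) : ℝ≥0∞ := if t = ⊤ then ⊤ else ENNReal.ofReal t.toReal

/-- Integral of an extended-real-valued function, with value in `EReal`. -/
def eintegral {α : Type*} [MeasurableSpace α] (μ : Measure α) (g : α → EReal) : EReal :=
  ((∫⁻ x, ERealPos (g x) ∂μ : ℝ≥0∞) : EReal) - ((∫⁻ x, ERealPos (-(g x)) ∂μ : ℝ≥0∞) : EReal)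

variable [MeasurableSpace E]

/-- The maximal correlation transport cost `𝒯(μ₁, μ₂)`. -/
def mcCost (μ₁ μ₂ : Measure E) : EReal :=
  ⨅ f : {f : E → EReal // IsProperConvexLSC f},
    eintegral μ₁ f.1 + eintegral μ₂ (fenchel f.1)

/-- The probability measure proportional to `e^{-W}` (with respect to Lebesgue measure). -/
def probOf {n : ℕ} (W : EuclideanSpace ℝ (Fin n) → ℝ) : Measure (EuclideanSpace ℝ (Fin n)) :=
  (∫⁻ x, ENNReal.ofReal (Real.exp (-(W x))))⁻¹ •
    volume.withDensity (fun x => ENNReal.ofReal (Real.exp (-(W x))))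

/-- Relative entropy with respect to the Lebesgue measure. -/
def relEnt {n : ℕ} (μ : Measure (EuclideanSpace ℝ (Fin n))) : ℝ :=
  ∫ x, Real.log ((μ.rnDeriv volume x).toReal) ∂μ

theorem exists_two_mul_norm_sub_le {F : Type*} [NormedAddCommGroup F] [InnerProductSpace ℝ F]
    [FiniteDimensional ℝ F] {W U : F → ℝ} (hU : Continuous U)
    (h : ∀ x y, ⟪x, y⟫_ℝ ≤ W x + U y) : ∃ C, ∀ x, 2 * ‖x‖ - C ≤ W x := by
  obtain ⟨C, hC⟩ := (isCompact_closedBall (0 : F) 2).bddAbove_image hU.continuousOn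
  refine ⟨C, fun x => ?_⟩
  have hn : ‖(2 / ‖x‖) • x‖ ≤ 2 := by
    rw [norm_smul, Real.norm_of_nonneg (by positivity)]
    rcases eq_or_ne ‖x‖ 0 with h0 | h0
    · simp [h0]
    · exact (div_mul_cancel₀ _ h0).le
  have h1 := hC (mem_image_of_mem U (mem_closedBall_zero_iff.2 hn))
  have h2 := h x ((2 / ‖x‖) • x)
  have h3 : ⟪x, (2 / ‖x‖) • x⟫_ℝ = 2 * ‖x‖ := by
    rw [real_inner_smul_right, real_inner_self_eq_norm_sq]
    rcases eq_or_ne ‖x‖ 0 with h0 | h0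
    · simp [h0]
    · field_simp
  linarith

theorem ConvexOn.add_inner_gradient_le {F : Type*} [NormedAddCommGroup F] [InnerProductSpace ℝ F]
    [CompleteSpace F] {W : F → ℝ} (hW : ConvexOn ℝ univ W)
    {x : F} (hx : DifferentiableAt ℝ W x) (y : F) :
    W x + ⟪y - x, gradient W x⟫_ℝ ≤ W y := by
  have hd : HasDerivAt (fun t : ℝ => W (x + t • (y - x))) (fderiv ℝ W x (y - x)) 0 :=
    (hx.hasFDerivAt.hasLineDerivAt (y - x))
  have h1 : fderiv ℝ W x (y - x) ≤ W y - W x := by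
    refine le_of_tendsto hd.tendsto_slope_zero_right ?_
    filter_upwards [Ioc_mem_nhdsGT (zero_lt_one' ℝ)] with t ht
    have := hW.2 (mem_univ x) (mem_univ y) (sub_nonneg.2 ht.2) ht.1.le (by ring)
    have he : (1 - t) • x + t • y = x + t • (y - x) := by module
    rw [he] at this
    simp only [smul_eq_mul] at this
    simp only [zero_add, zero_smul, add_zero, smul_eq_mul]
    rw [inv_mul_le_iff₀ ht.1]
    linarith
  have h2 : ⟪y - x, gradient W x⟫_ℝ = fderiv ℝ W x (y - x) := by
    rw [real_inner_comm, gradient, InnerProductSpace.toDual_symm_apply]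
  linarith

theorem ConvexOn.continuous_of_univ {F : Type*} [NormedAddCommGroup F] [InnerProductSpace ℝ F]
    [FiniteDimensional ℝ F] {W : F → ℝ}
    (hW : ConvexOn ℝ univ W) : Continuous W :=
  continuousOn_univ.1 (hW.continuousOn isOpen_univ)

theorem ConvexOn.ae_differentiableAt [FiniteDimensional ℝ E] [BorelSpace E] (μ : Measure E)
    [μ.IsAddHaarMeasure] {W : E → ℝ} (hW : ConvexOn ℝ univ W) :
    ∀ᵐ x ∂μ, DifferentiableAt ℝ W x := by
  have hlip : LocallyLipschitz W := locallyLipschitzOn_univ.1 (hW.locallyLipschitzOn isOpen_univ)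
  refine measure_null_of_locally_null _ fun x _ => ?_
  obtain ⟨K, t, ht, hKt⟩ := hlip x
  refine ⟨_, inter_mem_nhdsWithin _ (interior_mem_nhds.2 ht), ?_⟩
  refine measure_mono_null ?_
    (ae_iff.1 ((hKt.mono interior_subset).ae_differentiableWithinAt_of_mem (μ := μ)))
  intro z hz h
  exact hz.1 ((h hz.2).differentiableAt (isOpen_interior.mem_nhds hz.2))

theorem integrable_exp_neg_norm [FiniteDimensional ℝ E] [BorelSpace E] (μ : Measure E)
    [μ.IsAddHaarMeasure] : Integrable (fun x => Real.exp (-‖x‖)) μ := by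
  set d := Module.finrank ℝ E
  have h : Integrable (fun x : E => (1 + ‖x‖) ^ (-((d + 1 : ℕ) : ℝ))) μ :=
    integrable_one_add_norm (by push_cast; exact lt_add_one _)
  refine (h.const_mul (Real.exp 1 * (d + 1).factorial)).mono' (by fun_prop) (.of_forall fun x => ?_)
  have hp : 0 < 1 + ‖x‖ := by positivity
  rw [Real.norm_of_nonneg (Real.exp_nonneg _), Real.rpow_neg hp.le, Real.rpow_natCast,
    ← div_eq_mul_inv, le_div_iff₀ (by positivity)]
  have h1 := Real.pow_div_factorial_le_exp _ hp.le (d + 1)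
  rw [div_le_iff₀ (by positivity), Real.exp_add] at h1
  calc Real.exp (-‖x‖) * (1 + ‖x‖) ^ (d + 1)
      ≤ Real.exp (-‖x‖) * (Real.exp 1 * Real.exp ‖x‖ * (d + 1).factorial) := by gcongr
    _ = (Real.exp (-‖x‖) * Real.exp ‖x‖) * (Real.exp 1 * (d + 1).factorial) := by ring
    _ = _ := by rw [← Real.exp_add]; simp

theorem integrable_exp_neg_of_norm_le [FiniteDimensional ℝ E] [BorelSpace E] (μ : Measure E)
    [μ.IsAddHaarMeasure] {W : E → ℝ} (hW : Continuous W) {C : ℝ} (hC : ∀ x, ‖x‖ - C ≤ W x) :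
    Integrable (fun x => Real.exp (-(W x))) μ := by
  refine ((integrable_exp_neg_norm μ).const_mul (Real.exp C)).mono'
    (by fun_prop) (.of_forall fun x => ?_)
  rw [Real.norm_of_nonneg (Real.exp_nonneg _), ← Real.exp_add]
  exact Real.exp_le_exp.2 (by linarith [hC x])

theorem integrable_exp_neg_mul_self [FiniteDimensional ℝ E] [BorelSpace E] (μ : Measure E)
    [μ.IsAddHaarMeasure] {W : E → ℝ} (hW : Continuous W) {C : ℝ}
    (hC : ∀ x, 2 * ‖x‖ - C ≤ W x) :
    Integrable (fun x => Real.exp (-(W x)) * W x) μ := by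
  have h1 : Integrable (fun x => Real.exp (-(W x))) μ :=
    integrable_exp_neg_of_norm_le μ hW (C := C) fun x => by linarith [hC x, norm_nonneg x]
  have h2 : Integrable (fun x => Real.exp (-(W x / 2))) μ :=
    integrable_exp_neg_of_norm_le μ (hW.div_const 2) (C := C / 2) fun x => by linarith [hC x]
  refine ((h2.const_mul 2).add (h1.const_mul |C|)).mono' (by fun_prop) (.of_forall fun x => ?_)
  have hm : |W x| ≤ 2 * Real.exp (W x / 2) + |C| := by
    have h3 := Real.add_one_le_exp (W x / 2)
    have h4 := Real.exp_pos (W x / 2)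
    have h5 := abs_nonneg C
    rw [abs_le]
    constructor <;> linarith [hC x, norm_nonneg x, le_abs_self C]
  have he : Real.exp (-(W x / 2)) = Real.exp (-(W x)) * Real.exp (W x / 2) := by
    rw [← Real.exp_add]; ring_nf
  simp only [Pi.add_apply]
  rw [he, norm_mul, Real.norm_of_nonneg (Real.exp_nonneg _), Real.norm_eq_abs]
  calc Real.exp (-(W x)) * |W x| ≤ Real.exp (-(W x)) * (2 * Real.exp (W x / 2) + |C|) := by gcongr
    _ = _ := by ring

theorem integrable_and_integral_le_of_tendsto {α : Type*} [MeasurableSpace α] {μ : Measure α}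
    {G : ℕ → α → ℝ} {f : α → ℝ} {B : ℝ} (hG : ∀ k, Integrable (G k) μ)
    (hpos : ∀ k x, 0 ≤ G k x) (hB : ∀ k, ∫ x, G k x ∂μ ≤ B)
    (hlim : ∀ᵐ x ∂μ, Filter.Tendsto (fun k => G k x) Filter.atTop (nhds (f x))) :
    Integrable f μ ∧ ∫ x, f x ∂μ ≤ B := by
  have hB0 : 0 ≤ B := (integral_nonneg (hpos 0)).trans (hB 0)
  have hf : AEStronglyMeasurable f μ :=
    aestronglyMeasurable_of_tendsto_ae _ (fun k => (hG k).aestronglyMeasurable) hlim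
  have hf0 : 0 ≤ᵐ[μ] f := by
    filter_upwards [hlim] with x hx using ge_of_tendsto' hx fun k => hpos k x
  have hl : ∫⁻ x, ENNReal.ofReal (f x) ∂μ ≤ ENNReal.ofReal B := by
    calc ∫⁻ x, ENNReal.ofReal (f x) ∂μ
        = ∫⁻ x, Filter.liminf (fun k => ENNReal.ofReal (G k x)) Filter.atTop ∂μ := by
          refine lintegral_congr_ae ?_
          filter_upwards [hlim] with x hx
          exact ((ENNReal.continuous_ofReal.tendsto _).comp hx).liminf_eq.symm
      _ ≤ Filter.liminf (fun k => ∫⁻ x, ENNReal.ofReal (G k x) ∂μ) Filter.atTop :=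
          lintegral_liminf_le' fun k => (hG k).aemeasurable.ennreal_ofReal
      _ ≤ ENNReal.ofReal B := by
          refine Filter.liminf_le_of_frequently_le' (.of_forall fun k => ?_)
          rw [← ofReal_integral_eq_lintegral_ofReal (hG k) (.of_forall (hpos k))]
          exact ENNReal.ofReal_le_ofReal (hB k)
  refine ⟨⟨hf, ?_⟩, ?_⟩
  · rw [hasFiniteIntegral_iff_ofReal hf0]
    exact hl.trans_lt ENNReal.ofReal_lt_top
  · rw [integral_eq_lintegral_of_nonneg_ae hf0 hf]
    exact ENNReal.toReal_le_of_le_ofReal hB0 hl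

theorem ConvexOn.integral_exp_neg_mul_inner_gradient_le [FiniteDimensional ℝ E] [BorelSpace E]
    (μ : Measure E) [μ.IsAddHaarMeasure] {W : E → ℝ} (hW : ConvexOn ℝ univ W) {m : ℝ}
    (hm : ∀ x, m ≤ W x) (hint : Integrable (fun x => Real.exp (-(W x))) μ) :
    Integrable (fun x => Real.exp (-(W x)) * ⟪x, gradient W x⟫_ℝ) μ ∧
      ∫ x, Real.exp (-(W x)) * ⟪x, gradient W x⟫_ℝ ∂μ
        ≤ Module.finrank ℝ E * ∫ x, Real.exp (-(W x)) ∂μ := by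
  set d := Module.finrank ℝ E
  set Z := ∫ x, Real.exp (-(W x)) ∂μ with hZ
  have hZ0 : 0 ≤ Z := integral_nonneg fun x => Real.exp_nonneg _
  set A := W 0 - m
  have hA : 0 ≤ A := sub_nonneg.2 (hm 0)
  set K := A * Real.exp A
  set s : ℕ → ℝ := fun k => 1 / ((k : ℝ) + 1)
  have hs0 : ∀ k, 0 < s k := fun k => by positivity
  have hs1 : ∀ k, s k ≤ 1 := fun k => by
    rw [div_le_one (by positivity)]; linarith [Nat.cast_nonneg (α := ℝ) k]
  set G : ℕ → E → ℝ := fun k x =>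
    -((s k)⁻¹ * (Real.exp (-(W ((1 + s k) • x))) - Real.exp (-(W x)))) + K * Real.exp (-(W x))
  have hint' : ∀ k, Integrable (fun x => Real.exp (-(W ((1 + s k) • x)))) μ := fun k =>
    (integrable_comp_smul_iff μ (fun x => Real.exp (-(W x)))
      (by have := hs0 k; positivity)).2 hint
  have key : Integrable (fun x => Real.exp (-(W x)) * ⟪x, gradient W x⟫_ℝ
      + K * Real.exp (-(W x))) μ ∧
      ∫ x, (Real.exp (-(W x)) * ⟪x, gradient W x⟫_ℝ + K * Real.exp (-(W x))) ∂μ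
        ≤ d * Z + K * Z := by
    refine integrable_and_integral_le_of_tendsto (G := G) (fun k => ?_) (fun k x => ?_)
      (fun k => ?_) ?_
    · exact (((hint' k).sub hint).const_mul _).neg.add (hint.const_mul K)
    · have h1 : W x - s k * A ≤ W ((1 + s k) • x) := by
        have ht : 0 < 1 + s k := by linarith [hs0 k]
        have hb : 0 ≤ s k * (1 + s k)⁻¹ := mul_nonneg (hs0 k).le (inv_nonneg.2 ht.le)
        have h2 := hW.2 (mem_univ ((1 + s k) • x)) (mem_univ 0) (inv_nonneg.2 ht.le) hb
          (by field_simp)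
        rw [smul_smul, inv_mul_cancel₀ ht.ne', one_smul, smul_zero, add_zero] at h2
        simp only [smul_eq_mul] at h2
        have h3 : W x * (1 + s k) ≤ W ((1 + s k) • x) + s k * W 0 := by
          calc W x * (1 + s k) ≤ _ := mul_le_mul_of_nonneg_right h2 ht.le
            _ = _ := by field_simp
        have h4 := mul_le_mul_of_nonneg_left (hm x) (hs0 k).le
        simp only [A]
        linarith
      have h5 : Real.exp (-(W ((1 + s k) • x))) ≤ Real.exp (-(W x)) * Real.exp (s k * A) := by
        rw [← Real.exp_add]
        exact Real.exp_le_exp.2 (by linarith)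
      have h6 : Real.exp (s k * A) - 1 ≤ s k * K := by
        have h7 := Real.add_one_le_exp (-(s k * A))
        have h8 := mul_le_mul_of_nonneg_right h7 (Real.exp_nonneg (s k * A))
        rw [← Real.exp_add, neg_add_cancel, Real.exp_zero] at h8
        have h9 : s k * A * Real.exp (s k * A) ≤ s k * A * Real.exp A := by
          have := (hs0 k).le
          gcongr
          exact mul_le_of_le_one_left hA (hs1 k)
        simp only [K]
        linarith
      have h10 : Real.exp (-(W ((1 + s k) • x))) - Real.exp (-(W x))
          ≤ s k * (K * Real.exp (-(W x))) := by
        have := mul_le_mul_of_nonneg_left h6 (Real.exp_nonneg (-(W x)))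
        linarith
      have h11 := (inv_mul_le_iff₀ (hs0 k)).2 h10
      simp only [G]
      linarith
    · have hi1 : ∫ x, Real.exp (-(W ((1 + s k) • x))) ∂μ = ((1 + s k) ^ d)⁻¹ * Z :=
        Measure.integral_comp_smul_of_nonneg μ (fun x => Real.exp (-(W x))) (1 + s k)
          (hR := by linarith [hs0 k])
      have hi2 : Integrable (fun x => -((s k)⁻¹ *
          (Real.exp (-(W ((1 + s k) • x))) - Real.exp (-(W x))))) μ :=
        (((hint' k).sub hint).const_mul _).neg
      simp only [G]
      rw [integral_add hi2 (hint.const_mul K),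
        integral_neg, integral_const_mul, integral_const_mul, integral_sub (hint' k) hint, hi1,
        ← hZ]
      have hb : 1 - d * s k ≤ ((1 + s k) ^ d)⁻¹ := by
        have h0 := hs0 k
        have hle : (1 + s k)⁻¹ ≤ 1 := inv_le_one_of_one_le₀ (by linarith)
        have h1 : (1 + s k)⁻¹ - 1 = -(s k * (1 + s k)⁻¹) := by field_simp; ring
        have h2 : 0 ≤ (1 + s k)⁻¹ := by positivity
        have h3 := one_add_mul_le_pow (a := (1 + s k)⁻¹ - 1) (by linarith) d
        rw [add_sub_cancel, inv_pow, h1] at h3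
        have h4 : (d : ℝ) * (s k * (1 + s k)⁻¹) ≤ d * s k := by
          gcongr
          exact mul_le_of_le_one_right h0.le hle
        linarith
      have h12 : -((s k)⁻¹ * (((1 + s k) ^ d)⁻¹ * Z - Z)) ≤ d * Z := by
        rw [← mul_neg, inv_mul_le_iff₀ (hs0 k)]
        nlinarith [mul_le_mul_of_nonneg_right hb hZ0]
      linarith
    · filter_upwards [hW.ae_differentiableAt μ] with x hx
      have hd : HasDerivAt (fun t : ℝ => Real.exp (-(W (x + t • x))))
          (Real.exp (-(W (x + (0 : ℝ) • x))) * -(fderiv ℝ W x x)) 0 :=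
        HasDerivAt.exp (HasDerivAt.neg (hx.hasFDerivAt.hasLineDerivAt x))
      have hst : Filter.Tendsto s Filter.atTop (nhdsWithin 0 {0}ᶜ) :=
        tendsto_nhdsWithin_iff.2 ⟨tendsto_one_div_add_atTop_nhds_zero_nat,
          .of_forall fun k => (hs0 k).ne'⟩
      have h13 := (hd.tendsto_slope_zero.comp hst).neg.add_const (K * Real.exp (-(W x)))
      have h14 : ⟪x, gradient W x⟫_ℝ = fderiv ℝ W x x := by
        rw [real_inner_comm, gradient, InnerProductSpace.toDual_symm_apply]
      rw [h14]
      simpa [G, add_smul] using h13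
  have hfi : Integrable (fun x => Real.exp (-(W x)) * ⟪x, gradient W x⟫_ℝ) μ :=
    (key.1.sub (hint.const_mul K)).congr (.of_forall fun x => add_sub_cancel_right _ _)
  refine ⟨hfi, ?_⟩
  have h15 := key.2
  rw [integral_add hfi (hint.const_mul K), integral_const_mul, ← hZ] at h15
  linarith

theorem fenchel_coe_gradient {F : Type*} [NormedAddCommGroup F] [InnerProductSpace ℝ F]
    [CompleteSpace F] {W : F → ℝ} (hW : ConvexOn ℝ univ W) {x : F} (hx : DifferentiableAt ℝ W x) :
    fenchel (fun z => (W z : EReal)) (gradient W x) = ((⟪x, gradient W x⟫_ℝ - W x : ℝ) : EReal) := by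
  unfold fenchel
  refine le_antisymm (iSup_le fun z => ?_) ?_
  · rw [← EReal.coe_sub, EReal.coe_le_coe_iff]
    have := hW.add_inner_gradient_le hx z
    rw [inner_sub_left] at this
    linarith
  · rw [EReal.coe_sub]
    exact le_iSup (fun z => (⟪z, gradient W x⟫_ℝ : EReal) - (W z : EReal)) x

theorem lowerSemicontinuous_fenchel_coe {F : Type*} [NormedAddCommGroup F]
    [InnerProductSpace ℝ F] (W : F → ℝ) :
    LowerSemicontinuous (fenchel fun z => (W z : EReal)) := by
  refine lowerSemicontinuous_iSup fun z => Continuous.lowerSemicontinuous ?_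
  simp_rw [← EReal.coe_sub]
  exact continuous_coe_real_ereal.comp (by fun_prop)

theorem measurable_gradient [FiniteDimensional ℝ E] [BorelSpace E] (W : E → ℝ) :
    Measurable (gradient W) :=
  (InnerProductSpace.toDual ℝ E).symm.continuous.measurable.comp (measurable_fderiv ℝ W)

theorem measurable_ERealPos : Measurable ERealPos :=
  Measurable.ite (measurableSet_singleton _) measurable_const measurable_ereal_toReal.ennreal_ofReal

theorem eintegral_map {α β : Type*} [MeasurableSpace α] [MeasurableSpace β] {μ : Measure α}
    {T : α → β} (hT : Measurable T) {g : β → EReal} (hg : Measurable g) :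
    eintegral (μ.map T) g = eintegral μ (g ∘ T) := by
  unfold eintegral
  congr 2
  · exact lintegral_map (measurable_ERealPos.comp hg) hT
  · exact lintegral_map (measurable_ERealPos.comp hg.neg) hT

theorem eintegral_congr_ae {α : Type*} [MeasurableSpace α] {μ : Measure α} {g h : α → EReal}
    (hgh : g =ᵐ[μ] h) : eintegral μ g = eintegral μ h := by
  unfold eintegral
  congr 2
  · exact lintegral_congr_ae (hgh.mono fun x hx => by simp only [hx])
  · exact lintegral_congr_ae (hgh.mono fun x hx => by simp only [hx])

theorem eintegral_coe {α : Type*} [MeasurableSpace α] {μ : Measure α} {h : α → ℝ}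
    (hh : Integrable h μ) : eintegral μ (fun x => (h x : EReal)) = ((∫ x, h x ∂μ : ℝ) : EReal) := by
  have hpos : ∀ r : ℝ, ERealPos (r : EReal) = ENNReal.ofReal r := fun r => by simp [ERealPos]
  have hneg : ∫⁻ x, ENNReal.ofReal (-(h x)) ∂μ ≠ ⊤ := hh.neg.lintegral_lt_top.ne
  rw [integral_eq_lintegral_pos_part_sub_lintegral_neg_part hh, EReal.coe_sub,
    EReal.coe_ennreal_toReal hh.lintegral_lt_top.ne,
    EReal.coe_ennreal_toReal hneg]
  simp_rw [eintegral, ← EReal.coe_neg, hpos]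

section Potential

variable {n : ℕ} {W : EuclideanSpace ℝ (Fin n) → ℝ}

theorem probOf_eq_withDensity (hW : Continuous W)
    (hint : Integrable fun x => Real.exp (-(W x))) :
    probOf W = volume.withDensity
      (fun x => ENNReal.ofReal (Real.exp (-(W x)) / ∫ x, Real.exp (-(W x)))) := by
  have hZ : 0 < ∫ x, Real.exp (-(W x)) := integral_exp_pos hint
  rw [probOf, ← ofReal_integral_eq_lintegral_ofReal hint (.of_forall fun x => Real.exp_nonneg _),
    ← ENNReal.ofReal_inv_of_pos hZ, ← withDensity_smul _ (by fun_prop)]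
  congr 1
  ext x
  rw [Pi.smul_apply, smul_eq_mul, ← ENNReal.ofReal_mul (inv_nonneg.2 hZ.le), inv_mul_eq_div]

theorem integrable_probOf (hW : Continuous W) (hint : Integrable fun x => Real.exp (-(W x)))
    {g : EuclideanSpace ℝ (Fin n) → ℝ} (hg : Integrable fun x => Real.exp (-(W x)) * g x) :
    Integrable g (probOf W) := by
  rw [probOf_eq_withDensity hW hint, integrable_withDensity_iff_integrable_smul' (by fun_prop)
    (.of_forall fun x => ENNReal.ofReal_lt_top)]
  refine (hg.div_const (∫ x, Real.exp (-(W x)))).congr (.of_forall fun x => ?_)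
  have hZ : 0 < ∫ x, Real.exp (-(W x)) := integral_exp_pos hint
  simp only [smul_eq_mul]
  rw [ENNReal.toReal_ofReal (by positivity)]
  ring

theorem integral_probOf (hW : Continuous W) (hint : Integrable fun x => Real.exp (-(W x)))
    (g : EuclideanSpace ℝ (Fin n) → ℝ) :
    ∫ x, g x ∂(probOf W) = (∫ x, Real.exp (-(W x)) * g x) / ∫ x, Real.exp (-(W x)) := by
  have hZ : 0 < ∫ x, Real.exp (-(W x)) := integral_exp_pos hint
  rw [probOf_eq_withDensity hW hint, integral_withDensity_eq_integral_toReal_smul (by fun_prop)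
    (.of_forall fun x => ENNReal.ofReal_lt_top), ← integral_div]
  refine integral_congr_ae (.of_forall fun x => ?_)
  simp only [smul_eq_mul]
  rw [ENNReal.toReal_ofReal (by positivity)]
  ring

theorem probOf_absolutelyContinuous (W : EuclideanSpace ℝ (Fin n) → ℝ) : probOf W ≪ volume :=
  (withDensity_absolutelyContinuous _ _).smul_left _

theorem relEnt_probOf (hW : Continuous W) (hint : Integrable fun x => Real.exp (-(W x)))
    (hint' : Integrable fun x => Real.exp (-(W x)) * W x) :
    relEnt (probOf W) = -(∫ x, W x ∂(probOf W)) - Real.log (∫ x, Real.exp (-(W x))) := by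
  have hZ : 0 < ∫ x, Real.exp (-(W x)) := integral_exp_pos hint
  have hd : (probOf W).rnDeriv volume =ᵐ[probOf W]
      fun x => ENNReal.ofReal (Real.exp (-(W x)) / ∫ x, Real.exp (-(W x))) := by
    refine (probOf_absolutelyContinuous W).ae_le ?_
    rw [probOf_eq_withDensity hW hint]
    exact Measure.rnDeriv_withDensity _ (by fun_prop)
  have h1 : Integrable (fun _ => (1 : ℝ)) (probOf W) :=
    integrable_probOf hW hint (by simpa using hint)
  have h2 : ∫ _, (1 : ℝ) ∂(probOf W) = 1 := by
    rw [integral_probOf hW hint]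
    simpa using div_self hZ.ne'
  calc relEnt (probOf W)
      = ∫ x, (-(W x) - Real.log (∫ x, Real.exp (-(W x))) * 1) ∂(probOf W) := by
        refine integral_congr_ae (hd.mono fun x hx => ?_)
        simp only [hx]
        rw [ENNReal.toReal_ofReal (by positivity), Real.log_div (Real.exp_pos _).ne' hZ.ne',
          Real.log_exp, mul_one]
    _ = _ := by
        have h3 : Integrable (fun x => -(W x)) (probOf W) := (integrable_probOf hW hint hint').neg
        rw [integral_sub h3 (h1.const_mul _), integral_neg,
          integral_const_mul, h2, mul_one]

theorem eintegral_fenchel_momentMeasure_le (hW : ConvexOn ℝ univ W) {C : ℝ}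
    (hC : ∀ x, 2 * ‖x‖ - C ≤ W x) :
    eintegral (Measure.map (gradient W) (probOf W)) (fenchel fun z => (W z : EReal))
      ≤ ((n - ∫ x, W x ∂(probOf W) : ℝ) : EReal) := by
  have hc := hW.continuous_of_univ
  have hint := integrable_exp_neg_of_norm_le volume hc (C := C)
    fun x => by linarith [hC x, norm_nonneg x]
  have hint' := integrable_exp_neg_mul_self volume hc hC
  obtain ⟨hi, hle⟩ := hW.integral_exp_neg_mul_inner_gradient_le volume (m := -C)
    (fun x => by linarith [hC x, norm_nonneg x]) hint
  have hZ : 0 < ∫ x, Real.exp (-(W x)) := integral_exp_pos hint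
  have hip := integrable_probOf hc hint hi
  have hWp := integrable_probOf hc hint hint'
  have hsub : Integrable (fun x => ⟪x, gradient W x⟫_ℝ - W x) (probOf W) := hip.sub hWp
  have hae : (fenchel fun z => (W z : EReal)) ∘ gradient W =ᵐ[probOf W]
      fun x => ((⟪x, gradient W x⟫_ℝ - W x : ℝ) : EReal) := by
    filter_upwards [(probOf_absolutelyContinuous W).ae_le (hW.ae_differentiableAt volume)] with x hx
    exact fenchel_coe_gradient hW hx
  rw [eintegral_map (measurable_gradient W) (lowerSemicontinuous_fenchel_coe W).measurable,
    eintegral_congr_ae hae, eintegral_coe hsub, EReal.coe_le_coe_iff,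
    integral_sub hip hWp, integral_probOf hc hint fun x => ⟪x, gradient W x⟫_ℝ]
  rw [finrank_euclideanSpace_fin] at hle
  linarith [(div_le_iff₀ hZ).2 hle]

end Potential

theorem isProperConvexLSC_coe {F : Type*} [NormedAddCommGroup F] [InnerProductSpace ℝ F]
    {W : F → ℝ} (hW : ConvexOn ℝ univ W) (hc : Continuous W) :
    IsProperConvexLSC fun x => (W x : EReal) := by
  refine ⟨fun x y a b ha hb hab => ?_, (continuous_coe_real_ereal.comp hc).lowerSemicontinuous,
    fun x => EReal.coe_ne_bot _, 0, EReal.coe_ne_top _⟩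
  have := hW.2 (mem_univ x) (mem_univ y) ha hb hab
  simp only [smul_eq_mul] at this
  dsimp only
  exact_mod_cast this

theorem convexOn_of_coe_eq_fenchelR {F : Type*} [NormedAddCommGroup F] [InnerProductSpace ℝ F]
    {V Vs : F → ℝ} (hVs : ∀ y, (Vs y : EReal) = fenchelR V y) : ConvexOn ℝ univ Vs := by
  have hle : ∀ x y, ⟪x, y⟫_ℝ - V x ≤ Vs y := fun x y => by
    rw [← EReal.coe_le_coe_iff, hVs]
    exact le_iSup (fun x => ((⟪x, y⟫_ℝ - V x : ℝ) : EReal)) x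
  refine ⟨convex_univ, fun y _ z _ a b ha hb hab => ?_⟩
  rw [← EReal.coe_le_coe_iff, hVs]
  refine iSup_le fun x => EReal.coe_le_coe_iff.2 ?_
  simp only [inner_add_right, real_inner_smul_right, smul_eq_mul]
  have h1 := mul_le_mul_of_nonneg_left (hle x y) ha
  have h2 := mul_le_mul_of_nonneg_left (hle x z) hb
  have h3 : V x = a * V x + b * V x := by rw [← add_mul, hab, one_mul]
  linarith

/-- Proposition 2.3. Let `V : ℝⁿ → ℝ` be convex with everywhere finite
Fenchel-Legendre transform `V*`; let `η, η*` be the probability measures proportional to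
`e^{-V}, e^{-V*}` and `ν = ∇V # η`, `ν* = ∇V* # η*` their moment measures. If
`H(η) + H(η*) ≤ -n log(c e²) + 𝒯(ν, ν*)` for some `c > 0`, then
`∫ e^{-V} dx ∫ e^{-V*} dx ≥ cⁿ`. -/
theorem statement2 {n : ℕ} (c : ℝ) (hc : 0 < c)
    (V : EuclideanSpace ℝ (Fin n) → ℝ) (hVconv : ConvexOn ℝ Set.univ V)
    (hVstar : ∀ y, fenchelR V y ≠ ⊤)
    (Vs : EuclideanSpace ℝ (Fin n) → ℝ) (hVs : ∀ y, (Vs y : EReal) = fenchelR V y)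
    (η ηs : Measure (EuclideanSpace ℝ (Fin n)))
    (hη : η = probOf V) (hηs : ηs = probOf Vs)
    (ν νs : Measure (EuclideanSpace ℝ (Fin n)))
    (hν : ν = Measure.map (gradient V) η) (hνs : νs = Measure.map (gradient Vs) ηs)
    (hET : ((relEnt η + relEnt ηs : ℝ) : EReal)
        ≤ ((-(n * Real.log (c * Real.exp 2)) : ℝ) : EReal) + mcCost ν νs) :
    (∫ x, Real.exp (-(V x))) * (∫ y, Real.exp (-(Vs y))) ≥ c ^ n := by
  subst hη hηs hν hνs
  have hVsconv : ConvexOn ℝ univ Vs := convexOn_of_coe_eq_fenchelR hVs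
  have hyoung : ∀ x y, ⟪x, y⟫_ℝ ≤ V x + Vs y := fun x y => by
    have h : ((⟪x, y⟫_ℝ - V x : ℝ) : EReal) ≤ Vs y := by
      rw [hVs]
      exact le_iSup (fun x => ((⟪x, y⟫_ℝ - V x : ℝ) : EReal)) x
    linarith [EReal.coe_le_coe_iff.1 h]
  have hcV := hVconv.continuous_of_univ
  have hcVs := hVsconv.continuous_of_univ
  obtain ⟨C, hC⟩ := exists_two_mul_norm_sub_le hcVs hyoung
  obtain ⟨D, hD⟩ := exists_two_mul_norm_sub_le hcV (W := Vs) fun x y => by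
    rw [real_inner_comm, add_comm]
    exact hyoung y x
  have hint := integrable_exp_neg_of_norm_le volume hcV (C := C)
    fun x => by linarith [hC x, norm_nonneg x]
  have hints := integrable_exp_neg_of_norm_le volume hcVs (C := D)
    fun x => by linarith [hD x, norm_nonneg x]
  have hZ : 0 < ∫ x, Real.exp (-(V x)) := integral_exp_pos hint
  have hZs : 0 < ∫ x, Real.exp (-(Vs x)) := integral_exp_pos hints
  have hf : (fun y => (Vs y : EReal)) = fenchel fun x => (V x : EReal) := by
    ext y
    simp only [hVs, fenchelR, fenchel, EReal.coe_sub]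
  have hcost : mcCost (Measure.map (gradient V) (probOf V)) (Measure.map (gradient Vs) (probOf Vs))
      ≤ ((n - ∫ x, V x ∂(probOf V) : ℝ) : EReal) + ((n - ∫ x, Vs x ∂(probOf Vs) : ℝ) : EReal) := by
    refine (iInf_le _ ⟨_, isProperConvexLSC_coe hVsconv hcVs⟩).trans (add_le_add ?_ ?_)
    · simp only [hf]
      exact eintegral_fenchel_momentMeasure_le hVconv hC
    · exact eintegral_fenchel_momentMeasure_le hVsconv hD
  have hreal := hET.trans (add_le_add le_rfl hcost)
  rw [← EReal.coe_add, ← EReal.coe_add, EReal.coe_le_coe_iff,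
    relEnt_probOf hcV hint (integrable_exp_neg_mul_self volume hcV hC),
    relEnt_probOf hcVs hints (integrable_exp_neg_mul_self volume hcVs hD),
    Real.log_mul hc.ne' (Real.exp_pos _).ne', Real.log_exp] at hreal
  rw [ge_iff_le, ← Real.log_le_log_iff (by positivity) (mul_pos hZ hZs), Real.log_pow,
    Real.log_mul hZ.ne' hZs.ne']
  linarith

end
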